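/- Let Γ : Ω → ℕ be measurable and for each k fix an ℱ_k-measurable version Π_k of μ[1_{{Γ > k}} | ℱ_k] with 0 ≤ Π_k ≤ 1 pointwise. Let α ∈ [0, 1] and define the hitting time τ_α := inf{ k ∈ ℕ : Π_k ≤ α } (with value ∞ if no such k exists). Then τ_α is a stopping time with respect to (ℱ_k), and the false alarm probability satisfies μ( {τ_α < ∞} ∩ {Γ > τ_α} ) ≤ α. In particular, for the threshold rule with α = c₁/(c₁ + ρ) (c₁ > 0, 0 < ρ ≤ 1), the probability of raising an alarm strictly before the change point is at most c₁/(c₁ + ρ). -/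

import Mathlib

open MeasureTheory ProbabilityTheory
open scoped ENNReal

/-- The threshold (hitting) time `τ_α := inf {k : Π_k ≤ α}`, with value `∞` (`⊤ : ℕ∞`)
if no such `k` exists. -/
noncomputable def thresholdTime {Ω : Type*} (Pi : ℕ → Ω → ℝ) (α : ℝ) (ω : Ω) : ℕ∞ :=
  ⨅ (k : ℕ) (_ : Pi k ω ≤ α), (k : ℕ∞)

lemma thresholdTime_eq_iff {Ω : Type*} (Pi : ℕ → Ω → ℝ) (α : ℝ) (ω : Ω) (k : ℕ) :
    thresholdTime Pi α ω = (k : ℕ∞) ↔ Pi k ω ≤ α ∧ ∀ j < k, ¬ Pi j ω ≤ α := by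
  classical
  have hle : ∀ j, Pi j ω ≤ α → thresholdTime Pi α ω ≤ (j : ℕ∞) := fun j hj =>
    iInf₂_le (f := fun (k : ℕ) (_ : Pi k ω ≤ α) => (k : ℕ∞)) j hj
  constructor
  · intro h
    have h2 : ∀ j < k, ¬ Pi j ω ≤ α := by
      intro j hj hP
      have := hle j hP
      rw [h] at this
      have : k ≤ j := by exact_mod_cast this
      omega
    refine ⟨?_, h2⟩
    by_contra hk
    have : ((k + 1 : ℕ) : ℕ∞) ≤ thresholdTime Pi α ω := by
      refine le_iInf₂ fun j hj => ?_
      have h3 : ¬ j < k := fun hlt => h2 j hlt hj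
      have h4 : j ≠ k := fun e => hk (e ▸ hj)
      have : k + 1 ≤ j := by omega
      exact_mod_cast this
    rw [h] at this
    have : k + 1 ≤ k := by exact_mod_cast this
    omega
  · rintro ⟨hk, h2⟩
    refine le_antisymm (hle k hk) (le_iInf₂ fun j hj => ?_)
    have : k ≤ j := not_lt.mp fun hlt => h2 j hlt hj
    exact_mod_cast this

lemma thresholdTime_measurableSet {Ω : Type*} {𝒜 : MeasurableSpace Ω}
    (ℱ : Filtration ℕ 𝒜) (Pi : ℕ → Ω → ℝ)
    (hPi_meas : ∀ k, StronglyMeasurable[ℱ k] (Pi k)) (α : ℝ) (k : ℕ) :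
    MeasurableSet[ℱ k] {ω | thresholdTime Pi α ω = (k : ℕ∞)} := by
  have hm : ∀ j ≤ k, MeasurableSet[ℱ k] {ω | Pi j ω ≤ α} := fun j hj =>
    ℱ.mono hj _ ((hPi_meas j).measurable measurableSet_Iic)
  have : {ω | thresholdTime Pi α ω = (k : ℕ∞)}
      = {ω | Pi k ω ≤ α} ∩ ⋂ j ∈ Set.Iio k, {ω | Pi j ω ≤ α}ᶜ := by
    ext ω
    simp [thresholdTime_eq_iff]
  rw [this]
  exact (hm k le_rfl).inter
    (MeasurableSet.biInter (Set.to_countable _) fun j hj => (hm j (le_of_lt hj)).compl)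

lemma thresholdTime_bound {Ω : Type*} {𝒜 : MeasurableSpace Ω} (μ : Measure Ω)
    [IsProbabilityMeasure μ]
    (ℱ : Filtration ℕ 𝒜) (Γ : Ω → ℕ) (hΓ : Measurable Γ)
    (Pi : ℕ → Ω → ℝ)
    (hPi_meas : ∀ k, StronglyMeasurable[ℱ k] (Pi k))
    (hPi_ver : ∀ k, Pi k =ᵐ[μ] μ[Set.indicator {ω | k < Γ ω} (fun _ => (1 : ℝ)) | ℱ k])
    (α : ℝ) (hα₀ : 0 ≤ α) :
    μ ({ω | thresholdTime Pi α ω ≠ ⊤} ∩ {ω | thresholdTime Pi α ω < (Γ ω : ℕ∞)})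
      ≤ ENNReal.ofReal α := by
  set A : ℕ → Set Ω := fun k => {ω | thresholdTime Pi α ω = (k : ℕ∞)} with hA
  have hAk : ∀ k, MeasurableSet[ℱ k] (A k) :=
    thresholdTime_measurableSet ℱ Pi hPi_meas α
  have hAm : ∀ k, MeasurableSet (A k) := fun k => ℱ.le k _ (hAk k)
  have hG : ∀ k : ℕ, MeasurableSet {ω | k < Γ ω} := fun k => hΓ measurableSet_Ioi
  have hsub : ({ω | thresholdTime Pi α ω ≠ ⊤} ∩ {ω | thresholdTime Pi α ω < (Γ ω : ℕ∞)})
      ⊆ ⋃ k, A k ∩ {ω | k < Γ ω} := by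
    rintro ω ⟨h1, h2⟩
    obtain ⟨k, hk⟩ := ENat.ne_top_iff_exists.mp h1
    refine Set.mem_iUnion.mpr ⟨k, hk.symm, ?_⟩
    simp only [Set.mem_setOf_eq] at h2 ⊢
    rw [← hk] at h2
    exact_mod_cast h2
  have hk : ∀ k, μ (A k ∩ {ω | k < Γ ω}) ≤ ENNReal.ofReal α * μ (A k) := by
    intro k
    have hint : Integrable (Set.indicator {ω | k < Γ ω} (fun _ => (1 : ℝ))) μ :=
      (integrable_const 1).indicator (hG k)
    have hPint : Integrable (Pi k) μ := integrable_condExp.congr (hPi_ver k).symm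
    have e1 : ∫ ω in A k, Pi k ω ∂μ = μ.real (A k ∩ {ω | k < Γ ω}) := by
      rw [setIntegral_congr_ae (g := μ[Set.indicator {ω | k < Γ ω} (fun _ => (1 : ℝ)) | ℱ k])
        (hAm k) ((hPi_ver k).mono fun ω h _ => h), setIntegral_condExp (ℱ.le k) hint (hAk k),
        setIntegral_indicator (hG k)]
      simp
    have e2 : ∫ ω in A k, Pi k ω ∂μ ≤ ∫ ω in A k, α ∂μ :=
      setIntegral_mono_on hPint.integrableOn (integrable_const α).integrableOn (hAm k)
        fun ω hω => ((thresholdTime_eq_iff Pi α ω k).mp hω).1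
    have e3 : μ.real (A k ∩ {ω | k < Γ ω}) ≤ α * μ.real (A k) := by
      rw [e1] at e2
      simpa [mul_comm] using e2
    rw [← ofReal_measureReal, ← ofReal_measureReal (s := A k), ← ENNReal.ofReal_mul hα₀]
    exact ENNReal.ofReal_le_ofReal e3
  have hdisj : Pairwise (Function.onFun Disjoint A) := by
    intro i j hij
    refine Set.disjoint_left.mpr fun ω hi hj => hij ?_
    have : (i : ℕ∞) = j := Eq.trans (Eq.symm hi) hj
    exact_mod_cast this
  calc _ ≤ μ (⋃ k, A k ∩ {ω | k < Γ ω}) := measure_mono hsub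
    _ ≤ ∑' k, μ (A k ∩ {ω | k < Γ ω}) := measure_iUnion_le _
    _ ≤ ∑' k, ENNReal.ofReal α * μ (A k) := ENNReal.tsum_le_tsum hk
    _ = ENNReal.ofReal α * μ (⋃ k, A k) := by
      rw [ENNReal.tsum_mul_left, measure_iUnion hdisj hAm]
    _ ≤ ENNReal.ofReal α * 1 := by gcongr; exact prob_le_one
    _ = ENNReal.ofReal α := mul_one _

/-- with `Π_k` an `ℱ_k`-measurable version of `μ[1_{{Γ > k}} | ℱ_k]` taking
values in `[0,1]`, and `α ∈ [0,1]`, the hitting time `τ_α := inf{k : Π_k ≤ α}` is a stopping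
time for `(ℱ_k)` and the false alarm probability satisfies
`μ({τ_α < ∞} ∩ {Γ > τ_α}) ≤ α`. In particular, for the threshold `α = c₁/(c₁+ρ)`
(`c₁ > 0`, `0 < ρ ≤ 1`), the probability of raising an alarm strictly before the change
point is at most `c₁/(c₁+ρ)`. -/
theorem threshold_rule_false_alarm
    {Ω : Type*} {𝒜 : MeasurableSpace Ω} (μ : Measure Ω) [IsProbabilityMeasure μ]
    (ℱ : Filtration ℕ 𝒜) (Γ : Ω → ℕ) (hΓ : Measurable Γ)
    (Pi : ℕ → Ω → ℝ)
    (hPi_meas : ∀ k, StronglyMeasurable[ℱ k] (Pi k))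
    (hPi_ver : ∀ k, Pi k =ᵐ[μ] μ[Set.indicator {ω | k < Γ ω} (fun _ => (1 : ℝ)) | ℱ k])
    (hPi_bdd : ∀ k ω, 0 ≤ Pi k ω ∧ Pi k ω ≤ 1)
    (α : ℝ) (hα₀ : 0 ≤ α) (hα₁ : α ≤ 1) :
    (∀ k : ℕ, MeasurableSet[ℱ k] {ω | thresholdTime Pi α ω = (k : ℕ∞)}) ∧
    μ ({ω | thresholdTime Pi α ω ≠ ⊤} ∩ {ω | thresholdTime Pi α ω < (Γ ω : ℕ∞)})
      ≤ ENNReal.ofReal α ∧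
    ∀ c₁ ρ : ℝ, 0 < c₁ → 0 < ρ → ρ ≤ 1 →
      μ ({ω | thresholdTime Pi (c₁ / (c₁ + ρ)) ω ≠ ⊤}
          ∩ {ω | thresholdTime Pi (c₁ / (c₁ + ρ)) ω < (Γ ω : ℕ∞)})
        ≤ ENNReal.ofReal (c₁ / (c₁ + ρ)) := by
  refine ⟨thresholdTime_measurableSet ℱ Pi hPi_meas α,
    thresholdTime_bound μ ℱ Γ hΓ Pi hPi_meas hPi_ver α hα₀, fun c₁ ρ hc hρ _ => ?_⟩
  exact thresholdTime_bound μ ℱ Γ hΓ Pi hPi_meas hPi_ver _ (by positivity)
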